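/- arXiv:2409.18332 — 4 statements merged into one kernel-verified Lean document; each statement's English description precedes it below -/
import Mathlib

section
/- Exchangeability of scores produced by a permutation-equivariant model in the transductive setting: let (X, A, y) be a random triple with X ∈ ℝ^{N×d} (node features), A ∈ ℝ^{N×N} (adjacency matrix), and y ∈ Y^N (node labels), and let I ⊆ {1,…,N} be a set of indices (the calibration and test nodes). Suppose the joint law of (X, A, y) is invariant under every permutation σ of {1,…,N} that fixes {1,…,N}∖I pointwise, acting by X ↦ P_σ X, A ↦ P_σ A P_σ^T, and y ↦ (y_{σ^{-1}(v)})_v, where P_σ is the permutation matrix of σ. Let F : ℝ^{N×d} × ℝ^{N×N} → ℝ^{N×K} be measurable and permutation-equivariant, i.e., F(P_σ X, P_σ A P_σ^T) = P_σ F(X, A) for every permutation σ of {1,…,N}. Then for every measurable s : ℝ^K × Y → ℝ, the family of scores (s(F(X,A)_v, y_v))_{v ∈ I}, where F(X,A)_v denotes the v-th row of F(X,A), is exchangeable: its joint law is invariant under all permutations of the index set I. -/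
open MeasureTheory Matrix

noncomputable instance matrixMeasurableSpace (m n : Type*) :
    MeasurableSpace (Matrix m n ℝ) :=
  (inferInstanceAs (MeasurableSpace (m → n → ℝ)))

/-- The permutation matrix `P_σ` of a permutation `σ` of `{1,…,N}`:
`(P_σ)_{ij} = 1` if `i = σ(j)` and `0` otherwise. -/
def permMat {N : ℕ} (σ : Equiv.Perm (Fin N)) : Matrix (Fin N) (Fin N) ℝ :=
  Matrix.of fun i j => if σ j = i then 1 else 0

theorem permMat_mul_eq_submatrix {N : ℕ} {n : Type*} (σ : Equiv.Perm (Fin N))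
    (M : Matrix (Fin N) n ℝ) : permMat σ * M = M.submatrix σ.symm id := by
  ext i j
  simp [permMat, Matrix.mul_apply, ← Equiv.eq_symm_apply]

theorem mul_permMat_transpose_eq_submatrix {N : ℕ} {m : Type*} (σ : Equiv.Perm (Fin N))
    (M : Matrix m (Fin N) ℝ) : M * (permMat σ)ᵀ = M.submatrix id σ.symm := by
  ext i j
  simp [permMat, Matrix.mul_apply, ← Equiv.eq_symm_apply]

theorem measurable_matrix_apply {m n : Type*} (i : m) (j : n) :
    Measurable fun M : Matrix m n ℝ => M i j :=
  (measurable_pi_apply j).comp (measurable_pi_apply (X := fun _ : m => n → ℝ) i)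

theorem measurable_matrix_row {m n : Type*} (i : m) :
    Measurable fun M : Matrix m n ℝ => M i :=
  measurable_pi_apply (X := fun _ : m => n → ℝ) i

theorem measurable_matrix_submatrix {m n p q : Type*} (f : p → m) (g : q → n) :
    Measurable fun M : Matrix m n ℝ => M.submatrix f g :=
  measurable_pi_lambda (X := fun _ : p => q → ℝ) _ fun i =>
    measurable_pi_lambda _ fun j => measurable_matrix_apply (f i) (g j)

/-- **Exchangeability of scores from a permutation-equivariant model
(transductive setting).**
Let `(X, A, y)` be a random triple (node features in `ℝ^{N×d}`, adjacency matrix in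
`ℝ^{N×N}`, labels in `Y^N` with `Y = Fin K`), and let `I` be a set of node indices
(calibration and test nodes).  Assume the law of `(X, A, y)` is invariant under any
permutation `σ` of the nodes fixing the complement of `I` pointwise, acting by
`X ↦ P_σ X`, `A ↦ P_σ A P_σᵀ`, `y ↦ (y_{σ⁻¹ v})_v`.  If `F : ℝ^{N×d} × ℝ^{N×N} → ℝ^{N×K}`
is measurable and permutation-equivariant, then for every measurable
`s : ℝ^K × Y → ℝ`, the family of scores `(s(F(X,A)_v, y_v))_{v ∈ I}` is exchangeable. -/
theorem exchangeable_scores_of_equivariant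
    {Ω : Type*} [MeasurableSpace Ω] (ℙ : Measure Ω) [IsProbabilityMeasure ℙ]
    {N d K : ℕ} (hK : 0 < K)
    (W : Ω → Matrix (Fin N) (Fin d) ℝ × Matrix (Fin N) (Fin N) ℝ × (Fin N → Fin K))
    (hW : Measurable W)
    (I : Set (Fin N))
    (hinv : ∀ σ : Equiv.Perm (Fin N), (∀ v : Fin N, v ∉ I → σ v = v) →
      Measure.map (fun ω =>
          (permMat σ * (W ω).1,
           permMat σ * (W ω).2.1 * (permMat σ)ᵀ,
           fun v => (W ω).2.2 (σ.symm v))) ℙ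
        = Measure.map W ℙ)
    (F : Matrix (Fin N) (Fin d) ℝ × Matrix (Fin N) (Fin N) ℝ → Matrix (Fin N) (Fin K) ℝ)
    (hFmeas : Measurable F)
    (hFequiv : ∀ (σ : Equiv.Perm (Fin N)) (Xf : Matrix (Fin N) (Fin d) ℝ)
        (A : Matrix (Fin N) (Fin N) ℝ),
      F (permMat σ * Xf, permMat σ * A * (permMat σ)ᵀ) = permMat σ * F (Xf, A))
    (s : (Fin K → ℝ) × Fin K → ℝ) (hs : Measurable s) :
    ∀ τ : Equiv.Perm I,
      Measure.map (fun ω => fun v : I =>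
          s (F ((W ω).1, (W ω).2.1) ((τ v : I) : Fin N), (W ω).2.2 ((τ v : I) : Fin N))) ℙ
        = Measure.map (fun ω => fun v : I =>
          s (F ((W ω).1, (W ω).2.1) (v : Fin N), (W ω).2.2 (v : Fin N))) ℙ := by
  classical
  intro τ
  set σ : Equiv.Perm (Fin N) := Equiv.Perm.ofSubtype (p := (· ∈ I)) τ⁻¹ with hσ
  have σ_symm (v : I) : σ.symm v = τ v := by
    rw [Equiv.symm_apply_eq, hσ, Equiv.Perm.ofSubtype_apply_coe]
    simp
  have hG : Measurable fun (w : Matrix (Fin N) (Fin d) ℝ × Matrix (Fin N) (Fin N) ℝ ×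
      (Fin N → Fin K)) (v : I) => s (F (w.1, w.2.1) (v : Fin N), w.2.2 (v : Fin N)) := by
    refine measurable_pi_lambda _ fun v => hs.comp (Measurable.prodMk ?_ ?_)
    · exact (measurable_matrix_row (v : Fin N)).comp (hFmeas.comp (by fun_prop))
    · fun_prop
  have hTW : Measurable fun ω => (permMat σ * (W ω).1,
      permMat σ * (W ω).2.1 * (permMat σ)ᵀ, fun v => (W ω).2.2 (σ.symm v)) := by
    simp only [permMat_mul_eq_submatrix, mul_permMat_transpose_eq_submatrix]
    refine Measurable.prodMk ((measurable_matrix_submatrix _ _).comp (by fun_prop))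
      (Measurable.prodMk ?_ (by fun_prop))
    exact (measurable_matrix_submatrix _ _).comp
      ((measurable_matrix_submatrix _ _).comp (by fun_prop))
  have h := congrArg
    (Measure.map fun w (v : I) => s (F (w.1, w.2.1) (v : Fin N), w.2.2 (v : Fin N)))
    (hinv σ fun v hv => Equiv.Perm.ofSubtype_apply_of_not_mem _ hv)
  rw [Measure.map_map hG hTW, Measure.map_map hG hW] at h
  refine Eq.trans (congrArg (Measure.map · ℙ) ?_) h
  funext ω v
  simp only [Function.comp_apply, hFequiv, σ_symm]
  congr 2
  rw [permMat_mul_eq_submatrix]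
  funext j
  simp [σ_symm]
end

section
/- Two-sided bound on the expected prediction-set size: let Y = {1,…,K} with K ≥ 2, let (x_{n+1}, y_{n+1}) be a random test pair with label in Y, let C(x_{n+1}) ⊆ Y be a random prediction set, and let y_{n+1}^R be a random label that, conditionally on all other randomness, is uniformly distributed on Y∖{y_{n+1}}. Suppose for some α, α_c ∈ [0,1]: (i) 1 − α ≤ Pr[y_{n+1} ∈ C(x_{n+1})] ≤ 1 − α + 1/(n+1), and (ii) 1 − α_c ≤ Pr[y_{n+1}^R ∈ C(x_{n+1})] ≤ 1 − α_c + 1/(n+1). Then 1 − α + (K−1)(1 − α_c) ≤ E[|C(x_{n+1})|] ≤ 1 − α + (K−1)(1 − α_c) + K/(n+1). -/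
open MeasureTheory

/-- Law of the unconscious statistician for a random variable with finitely many values. -/
lemma integral_comp_eq_sum_of_fintype {Ω ι : Type*} [MeasurableSpace Ω] (μ : Measure Ω)
    [IsFiniteMeasure μ] [Fintype ι] (Z : Ω → ι) (hZ : ∀ i, MeasurableSet {ω | Z ω = i})
    (f : ι → ℝ) : ∫ ω, f (Z ω) ∂μ = ∑ i, μ.real {ω | Z ω = i} * f i := by
  let _ : MeasurableSpace ι := ⊤
  have hmeas : Measurable Z := measurable_to_countable' hZ
  rw [← integral_map (f := f) hmeas.aemeasurable
    (measurable_of_finite f).aestronglyMeasurable, integral_fintype Integrable.of_finite]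
  refine Finset.sum_congr rfl fun i _ => ?_
  rw [map_measureReal_apply hmeas (measurableSet_singleton i), smul_eq_mul]
  rfl

/-- The probability of an event determined by a random variable with finitely many values. -/
lemma measureReal_comp_eq_sum_of_fintype {Ω ι : Type*} [MeasurableSpace Ω] (μ : Measure Ω)
    [IsFiniteMeasure μ] [Fintype ι] (Z : Ω → ι) (hZ : ∀ i, MeasurableSet {ω | Z ω = i})
    (p : ι → Prop) [DecidablePred p] :
    μ.real {ω | p (Z ω)} = ∑ i, μ.real {ω | Z ω = i} * if p i then 1 else 0 := by
  let _ : MeasurableSpace ι := ⊤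
  have hmeas : Measurable Z := measurable_to_countable' hZ
  have hset : MeasurableSet {ω | p (Z ω)} := hmeas (MeasurableSet.of_discrete (s := {i | p i}))
  rw [← integral_comp_eq_sum_of_fintype μ Z hZ, ← integral_indicator_one hset]
  simp [Set.indicator_apply]

/-- Summing over the labels other than `y` the indicator of membership in `F`. -/
lemma sum_ite_ne_mul_ite_mem {ι : Type*} [Fintype ι] [DecidableEq ι] (y : ι) (F : Finset ι)
    (c : ℝ) :
    ∑ y', (if y' = y then 0 else c) * (if y' ∈ F then (1 : ℝ) else 0)
      = c * ((F.card : ℝ) - if y ∈ F then 1 else 0) := by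
  have hterm : ∀ y', (if y' = y then 0 else c) * (if y' ∈ F then (1 : ℝ) else 0)
      = c * (if y' ∈ F then 1 else 0) - if y' = y then c * (if y ∈ F then 1 else 0) else 0 := by
    intro y'
    by_cases h : y' = y
    · subst h; simp
    · simp [h]
  simp_rw [hterm, Finset.sum_sub_distrib, ← Finset.mul_sum]
  simp [mul_sub]

/-- The expected size of a random set of labels splits into the coverage of the label `yTest` and
`K - 1` times the coverage of a label drawn uniformly among the others. -/
lemma integral_card_eq_coverage_add {Ω : Type*} [MeasurableSpace Ω] (μ : Measure Ω)
    [IsFiniteMeasure μ] {K : ℕ} (hK : 2 ≤ K) (yTest yR : Ω → Fin K) (C : Ω → Finset (Fin K))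
    (hyT : ∀ yv : Fin K, MeasurableSet {ω | yTest ω = yv})
    (hyR : ∀ y' : Fin K, MeasurableSet {ω | yR ω = y'})
    (hC : ∀ F : Finset (Fin K), MeasurableSet {ω | C ω = F})
    (hcond : ∀ (yv y' : Fin K) (F : Finset (Fin K)),
      μ {ω | yTest ω = yv ∧ C ω = F ∧ yR ω = y'}
        = (if y' = yv then 0 else (((K - 1 : ℕ) : ENNReal))⁻¹)
            * μ {ω | yTest ω = yv ∧ C ω = F}) :
    ∫ ω, ((C ω).card : ℝ) ∂μ
      = μ.real {ω | yTest ω ∈ C ω} + ((K : ℝ) - 1) * μ.real {ω | yR ω ∈ C ω} := by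
  have hpair : ∀ i : Fin K × Finset (Fin K), MeasurableSet {ω | (yTest ω, C ω) = i} := by
    rintro ⟨y, F⟩
    simp only [Prod.mk.injEq]
    exact (hyT y).inter (hC F)
  have htriple : ∀ i : Fin K × Finset (Fin K) × Fin K,
      MeasurableSet {ω | (yTest ω, C ω, yR ω) = i} := by
    rintro ⟨y, F, y'⟩
    simp only [Prod.mk.injEq]
    exact (hyT y).inter ((hC F).inter (hyR y'))
  have hcond' : ∀ (y y' : Fin K) (F : Finset (Fin K)),
      μ.real {ω | yTest ω = y ∧ C ω = F ∧ yR ω = y'}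
        = μ.real {ω | yTest ω = y ∧ C ω = F} * (if y' = y then 0 else ((K : ℝ) - 1)⁻¹) := by
    intro y y' F
    rw [measureReal_def, hcond, ENNReal.toReal_mul, mul_comm, measureReal_def]
    split_ifs
    · simp
    · rw [ENNReal.toReal_inv, ENNReal.toReal_natCast, Nat.cast_sub (by omega), Nat.cast_one]
  have hK' : (K : ℝ) - 1 ≠ 0 := by
    have : (2 : ℝ) ≤ K := by exact_mod_cast hK
    linarith
  rw [integral_comp_eq_sum_of_fintype μ _ hpair (fun i => (i.2.card : ℝ)),
    measureReal_comp_eq_sum_of_fintype μ _ hpair (fun i => i.1 ∈ i.2),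
    measureReal_comp_eq_sum_of_fintype μ _ htriple (fun i => i.2.2 ∈ i.2.1)]
  simp only [Fintype.sum_prod_type, Prod.mk.injEq, hcond', mul_assoc, ← Finset.mul_sum,
    sum_ite_ne_mul_ite_mem]
  rw [Finset.mul_sum, ← Finset.sum_add_distrib]
  refine Finset.sum_congr rfl fun y _ => ?_
  rw [Finset.mul_sum, ← Finset.sum_add_distrib]
  refine Finset.sum_congr rfl fun F _ => ?_
  field_simp
  ring

/-- **Two-sided bound on the expected prediction-set size.**
Let `Y = Fin K` with `K ≥ 2`, `n ≥ 1` the calibration-set size, `y_{n+1}` a random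
test label, `C(x_{n+1}) ⊆ Y` a random prediction set, and `y_{n+1}^R` a random label
that, conditionally on all other randomness, is uniform on `Y ∖ {y_{n+1}}`.
If `1 - α ≤ Pr[y_{n+1} ∈ C] ≤ 1 - α + 1/(n+1)` and
`1 - α_c ≤ Pr[y_{n+1}^R ∈ C] ≤ 1 - α_c + 1/(n+1)`, then
`1 - α + (K-1)(1-α_c) ≤ E[|C|] ≤ 1 - α + (K-1)(1-α_c) + K/(n+1)`. -/
theorem expected_set_size_two_sided_bound
    {Ω : Type*} [MeasurableSpace Ω] (ℙ : Measure Ω) [IsProbabilityMeasure ℙ]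
    {K : ℕ} (hK : 2 ≤ K) {n : ℕ} (hn : 1 ≤ n)
    (yTest yR : Ω → Fin K) (C : Ω → Finset (Fin K))
    (hyT : ∀ yv : Fin K, MeasurableSet {ω | yTest ω = yv})
    (hyR : ∀ y' : Fin K, MeasurableSet {ω | yR ω = y'})
    (hC : ∀ F : Finset (Fin K), MeasurableSet {ω | C ω = F})
    -- conditionally on all other randomness, `yR` is uniform on `Y ∖ {yTest}`:
    (hcond : ∀ (yv y' : Fin K) (F : Finset (Fin K)),
      ℙ {ω | yTest ω = yv ∧ C ω = F ∧ yR ω = y'}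
        = (if y' = yv then 0 else (((K - 1 : ℕ) : ENNReal))⁻¹)
            * ℙ {ω | yTest ω = yv ∧ C ω = F})
    (α αc : ℝ) (hα : α ∈ Set.Icc (0 : ℝ) 1) (hαc : αc ∈ Set.Icc (0 : ℝ) 1)
    (hcov₁ : 1 - α ≤ (ℙ {ω | yTest ω ∈ C ω}).toReal)
    (hcov₂ : (ℙ {ω | yTest ω ∈ C ω}).toReal ≤ 1 - α + 1 / ((n : ℝ) + 1))
    (hcovR₁ : 1 - αc ≤ (ℙ {ω | yR ω ∈ C ω}).toReal)
    (hcovR₂ : (ℙ {ω | yR ω ∈ C ω}).toReal ≤ 1 - αc + 1 / ((n : ℝ) + 1)) :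
    1 - α + ((K : ℝ) - 1) * (1 - αc) ≤ ∫ ω, ((C ω).card : ℝ) ∂ℙ
      ∧ ∫ ω, ((C ω).card : ℝ) ∂ℙ
          ≤ 1 - α + ((K : ℝ) - 1) * (1 - αc) + (K : ℝ) / ((n : ℝ) + 1) := by
  have hsize := integral_card_eq_coverage_add ℙ hK yTest yR C hyT hyR hC hcond
  have hK' : 0 ≤ (K : ℝ) - 1 := by
    have : (2 : ℝ) ≤ K := by exact_mod_cast hK
    linarith
  rw [hsize]
  simp only [measureReal_def]
  have hlower := mul_le_mul_of_nonneg_left hcovR₁ hK'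
  have hupper := mul_le_mul_of_nonneg_left hcovR₂ hK'
  have hsplit : (K : ℝ) / ((n : ℝ) + 1)
      = 1 / ((n : ℝ) + 1) + ((K : ℝ) - 1) * (1 / ((n : ℝ) + 1)) := by ring
  constructor
  · linarith
  · rw [hsplit]
    linarith
end

section
/- Corollary (asymptotic efficiency gain): fix K ≥ 2 and α, α_c^A, α_c^Ã ∈ [0,1]. Suppose for every n ≥ 1 there are random prediction sets C_A^{(n)}(x_{n+1}), C_Ã^{(n)}(x_{n+1}) ⊆ Y = {1,…,K} satisfying: correct-label coverage of both lying in [1−α, 1−α+1/(n+1)], and random-incorrect-label coverage lying in [1−α_c^A, 1−α_c^A+1/(n+1)] for C_A^{(n)} and in [1−α_c^Ã, 1−α_c^Ã+1/(n+1)] for C_Ã^{(n)}, where the random incorrect label y_{n+1}^R is, conditionally on all other randomness, uniform on Y∖{y_{n+1}}. Then lim_{n→∞} E[|C_Ã^{(n)}(x_{n+1})| − |C_A^{(n)}(x_{n+1})|] = (K−1)(α_c^A − α_c^Ã). -/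
open MeasureTheory Filter

/-- The expectation of a function of a random variable with finitely many values. -/
theorem integral_comp_eq_sum_measureReal {Ω T : Type*} [MeasurableSpace Ω] [Fintype T]
    (μ : Measure Ω) [IsFiniteMeasure μ] (W : Ω → T)
    (hW : ∀ w, MeasurableSet {ω | W ω = w}) (f : T → ℝ) :
    ∫ ω, f (W ω) ∂μ = ∑ w, μ.real {ω | W ω = w} * f w := by
  classical
  have hsum : ∀ ω, f (W ω) = ∑ w, Set.indicator {ω | W ω = w} (fun _ => f w) ω := fun ω => by
    simp [Set.indicator_apply]
  simp_rw [hsum]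
  rw [integral_finsetSum _ fun w _ => (integrable_const (f w)).indicator (hW w)]
  simp [integral_indicator_const, hW]

/-- The probability of an event determined by a random variable with finitely many values. -/
theorem measureReal_setOf_comp_eq_sum {Ω T : Type*} [MeasurableSpace Ω] [Fintype T]
    (μ : Measure Ω) [IsFiniteMeasure μ] (W : Ω → T)
    (hW : ∀ w, MeasurableSet {ω | W ω = w}) (p : T → Prop) [DecidablePred p] :
    μ.real {ω | p (W ω)} = ∑ w, μ.real {ω | W ω = w} * if p w then 1 else 0 := by
  have hmeas : MeasurableSet {ω | p (W ω)} := by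
    have : {ω | p (W ω)} = ⋃ w ∈ {w | p w}, {ω | W ω = w} := by ext; simp
    rw [this]
    exact .biUnion (Set.to_countable _) fun w _ => hW w
  rw [← integral_comp_eq_sum_measureReal μ W hW, ← integral_indicator_one hmeas]
  simp [Set.indicator_apply]

/-- If `r` is, conditionally on `W`, uniform on the labels other than `y W`, then the expected size
of a label set determined by `W` is its coverage of `y W` plus `|Y| - 1` times its coverage
of `r`. -/
theorem integral_card_eq_coverage_add_s12 {Ω T Y : Type*} [MeasurableSpace Ω] [Fintype T]
    [Fintype Y] [DecidableEq Y] (hY : 2 ≤ Fintype.card Y)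
    (μ : Measure Ω) [IsFiniteMeasure μ] (W : Ω → T) (r : Ω → Y)
    (hW : ∀ w, MeasurableSet {ω | W ω = w}) (hr : ∀ v, MeasurableSet {ω | r ω = v})
    (y : T → Y) (c : T → Finset Y)
    (hcond : ∀ w v, μ {ω | W ω = w ∧ r ω = v} =
      (if v = y w then 0 else ((Fintype.card Y - 1 : ℕ) : ENNReal)⁻¹) * μ {ω | W ω = w}) :
    ∫ ω, ((c (W ω)).card : ℝ) ∂μ = μ.real {ω | y (W ω) ∈ c (W ω)} +
      ((Fintype.card Y : ℝ) - 1) * μ.real {ω | r ω ∈ c (W ω)} := by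
  have hpos : (Fintype.card Y : ℝ) - 1 ≠ 0 := by
    have : (2 : ℝ) ≤ Fintype.card Y := by exact_mod_cast hY
    linarith
  have hcond' : ∀ w v, μ.real {ω | (W ω, r ω) = (w, v)} =
      (if v = y w then 0 else ((Fintype.card Y : ℝ) - 1)⁻¹) * μ.real {ω | W ω = w} := by
    intro w v
    simp only [Prod.mk.injEq, Measure.real, hcond, ENNReal.toReal_mul]
    split_ifs
    · simp
    · rw [ENNReal.toReal_inv, ENNReal.toReal_natCast, Nat.cast_sub (by omega), Nat.cast_one]
  have hWr : ∀ t : T × Y, MeasurableSet {ω | (W ω, r ω) = t} := by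
    rintro ⟨w, v⟩
    simp only [Prod.mk.injEq]
    exact (hW w).inter (hr v)
  have hcount : ∀ w, ∑ v, (if v = y w then (0 : ℝ) else 1) * (if v ∈ c w then 1 else 0) =
      (c w).card - if y w ∈ c w then 1 else 0 := by
    intro w
    have : ∀ v, (if v = y w then (0 : ℝ) else 1) * (if v ∈ c w then 1 else 0) =
        (if v ∈ c w then 1 else 0) - if v = y w then (if y w ∈ c w then 1 else 0) else 0 := by
      intro v
      by_cases h : v = y w <;> simp [h]
    simp_rw [this, Finset.sum_sub_distrib]
    simp
  rw [integral_comp_eq_sum_measureReal μ W hW fun w => ((c w).card : ℝ),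
    measureReal_setOf_comp_eq_sum μ W hW fun w => y w ∈ c w,
    measureReal_setOf_comp_eq_sum μ (fun ω => (W ω, r ω)) hWr fun t => t.2 ∈ c t.1,
    Fintype.sum_prod_type, Finset.mul_sum, ← Finset.sum_add_distrib]
  refine Finset.sum_congr rfl fun w _ => ?_
  have hterm : ∀ v, μ.real {ω | (W ω, r ω) = (w, v)} * (if v ∈ c w then (1 : ℝ) else 0) =
      ((Fintype.card Y : ℝ) - 1)⁻¹ * μ.real {ω | W ω = w} *
        ((if v = y w then (0 : ℝ) else 1) * (if v ∈ c w then 1 else 0)) := by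
    intro v
    rw [hcond']
    split_ifs <;> simp
  simp_rw [hterm, ← Finset.mul_sum, hcount]
  field_simp
  ring

/-- A sequence within `1 / (n + 1)` above `a` for all `n ≥ 1` converges to `a`. -/
theorem tendsto_of_le_add_one_div {a : ℝ} {u : ℕ → ℝ} (hl : ∀ n, 1 ≤ n → a ≤ u n)
    (hu : ∀ n, 1 ≤ n → u n ≤ a + 1 / ((n : ℝ) + 1)) : Tendsto u atTop (nhds a) := by
  have hlim : Tendsto (fun n : ℕ => a + 1 / ((n : ℝ) + 1)) atTop (nhds a) := by
    simpa using tendsto_one_div_add_atTop_nhds_zero_nat.const_add a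
  refine tendsto_of_tendsto_of_tendsto_of_le_of_le' tendsto_const_nhds hlim ?_ ?_
  · filter_upwards [eventually_ge_atTop 1] with n hn using hl n hn
  · filter_upwards [eventually_ge_atTop 1] with n hn using hu n hn

/-- **Corollary (asymptotic efficiency gain).**
Fix `K ≥ 2` and `α, α_c^A, α_c^Ã ∈ [0,1]`.  Suppose for every calibration-set size
`n ≥ 1` there are random prediction sets `C_A^{(n)}, C_Ã^{(n)} ⊆ Y = Fin K`
satisfying: correct-label coverage of both in `[1-α, 1-α+1/(n+1)]`,
random-incorrect-label coverage in `[1-α_c^A, 1-α_c^A+1/(n+1)]` for `C_A^{(n)}` and in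
`[1-α_c^Ã, 1-α_c^Ã+1/(n+1)]` for `C_Ã^{(n)}`, where the random incorrect label
`y_{n+1}^R` is, conditionally on all other randomness, uniform on `Y ∖ {y_{n+1}}`.
Then `lim_{n→∞} E[|C_Ã^{(n)}| - |C_A^{(n)}|] = (K-1)(α_c^A - α_c^Ã)`. -/
theorem asymptotic_efficiency_gain
    {K : ℕ} (hK : 2 ≤ K)
    (α αcA αcT : ℝ)
    (hα : α ∈ Set.Icc (0 : ℝ) 1) (hαcA : αcA ∈ Set.Icc (0 : ℝ) 1)
    (hαcT : αcT ∈ Set.Icc (0 : ℝ) 1)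
    (Ω : ℕ → Type*) (inst : ∀ n, MeasurableSpace (Ω n))
    (ℙ : ∀ n, Measure (Ω n)) (hprob : ∀ n, IsProbabilityMeasure (ℙ n))
    (yTest yR : ∀ n, Ω n → Fin K) (CA CT : ∀ n, Ω n → Finset (Fin K))
    (hyT : ∀ n, ∀ yv : Fin K, MeasurableSet {ω | yTest n ω = yv})
    (hyR : ∀ n, ∀ y' : Fin K, MeasurableSet {ω | yR n ω = y'})
    (hCA : ∀ n, ∀ F : Finset (Fin K), MeasurableSet {ω | CA n ω = F})
    (hCT : ∀ n, ∀ F : Finset (Fin K), MeasurableSet {ω | CT n ω = F})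
    -- conditionally on all other randomness, `yR` is uniform on `Y ∖ {yTest}`:
    (hcond : ∀ n, 1 ≤ n → ∀ (yv y' : Fin K) (F G : Finset (Fin K)),
      ℙ n {ω | yTest n ω = yv ∧ CA n ω = F ∧ CT n ω = G ∧ yR n ω = y'}
        = (if y' = yv then 0 else (((K - 1 : ℕ) : ENNReal))⁻¹)
            * ℙ n {ω | yTest n ω = yv ∧ CA n ω = F ∧ CT n ω = G})
    (hcovA₁ : ∀ n, 1 ≤ n → 1 - α ≤ (ℙ n {ω | yTest n ω ∈ CA n ω}).toReal)
    (hcovA₂ : ∀ n, 1 ≤ n →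
      (ℙ n {ω | yTest n ω ∈ CA n ω}).toReal ≤ 1 - α + 1 / ((n : ℝ) + 1))
    (hcovT₁ : ∀ n, 1 ≤ n → 1 - α ≤ (ℙ n {ω | yTest n ω ∈ CT n ω}).toReal)
    (hcovT₂ : ∀ n, 1 ≤ n →
      (ℙ n {ω | yTest n ω ∈ CT n ω}).toReal ≤ 1 - α + 1 / ((n : ℝ) + 1))
    (hcovRA₁ : ∀ n, 1 ≤ n → 1 - αcA ≤ (ℙ n {ω | yR n ω ∈ CA n ω}).toReal)
    (hcovRA₂ : ∀ n, 1 ≤ n →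
      (ℙ n {ω | yR n ω ∈ CA n ω}).toReal ≤ 1 - αcA + 1 / ((n : ℝ) + 1))
    (hcovRT₁ : ∀ n, 1 ≤ n → 1 - αcT ≤ (ℙ n {ω | yR n ω ∈ CT n ω}).toReal)
    (hcovRT₂ : ∀ n, 1 ≤ n →
      (ℙ n {ω | yR n ω ∈ CT n ω}).toReal ≤ 1 - αcT + 1 / ((n : ℝ) + 1)) :
    Tendsto (fun n => ∫ ω, (((CT n ω).card : ℝ) - ((CA n ω).card : ℝ)) ∂(ℙ n))
      atTop (nhds (((K : ℝ) - 1) * (αcA - αcT))) := by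
  have key : ∀ n, 1 ≤ n → ∫ ω, (((CT n ω).card : ℝ) - ((CA n ω).card : ℝ)) ∂(ℙ n) =
      ((ℙ n {ω | yTest n ω ∈ CT n ω}).toReal +
        ((K : ℝ) - 1) * (ℙ n {ω | yR n ω ∈ CT n ω}).toReal) -
      ((ℙ n {ω | yTest n ω ∈ CA n ω}).toReal +
        ((K : ℝ) - 1) * (ℙ n {ω | yR n ω ∈ CA n ω}).toReal) := by
    intro n hn
    have := hprob n
    let W : Ω n → Fin K × Finset (Fin K) × Finset (Fin K) :=
      fun ω => (yTest n ω, CA n ω, CT n ω)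
    have hW : ∀ w, MeasurableSet {ω | W ω = w} := by
      rintro ⟨v, F, G⟩
      simp only [W, Prod.mk.injEq]
      exact (hyT n v).inter ((hCA n F).inter (hCT n G))
    have hsize := integral_card_eq_coverage_add_s12 (by simpa using hK) (ℙ n) W (yR n) hW (hyR n)
      (fun w => w.1) (hcond := by
        rintro ⟨v, F, G⟩ v'
        simpa [W, and_assoc] using hcond n hn v v' F G)
    have hA := hsize fun w => w.2.1
    have hT := hsize fun w => w.2.2
    simp only [W, Fintype.card_fin, Measure.real] at hA hT
    have hint : ∀ C : Ω n → Finset (Fin K), (∀ F, MeasurableSet {ω | C ω = F}) →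
        Integrable (fun ω => ((C ω).card : ℝ)) (ℙ n) := by
      intro C hC
      let : MeasurableSpace (Finset (Fin K)) := ⊤
      have hCm : Measurable C := measurable_to_countable' hC
      refine .of_bound ((measurable_from_top (f := fun F : Finset (Fin K) =>
        (F.card : ℝ))).comp hCm).aestronglyMeasurable K (.of_forall fun ω => ?_)
      simpa using Finset.card_le_univ (C ω)
    rw [integral_sub (hint _ (hCT n)) (hint _ (hCA n)), hA, hT]
  have hlim := ((tendsto_of_le_add_one_div hcovT₁ hcovT₂).add
      ((tendsto_of_le_add_one_div hcovRT₁ hcovRT₂).const_mul ((K : ℝ) - 1))).sub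
    ((tendsto_of_le_add_one_div hcovA₁ hcovA₂).add
      ((tendsto_of_le_add_one_div hcovRA₁ hcovRA₂).const_mul ((K : ℝ) - 1)))
  convert hlim.congr' ?_ using 2
  · ring
  · filter_upwards [eventually_ge_atTop 1] with n hn using (key n hn).symm
end

section
/- Miscoverage bound for a fixed threshold (expectation form of the conformal inversion lemma): let {(x_i, y_i)}_{i=1}^{n+1} be exchangeable pairs in X × Y, let s : X × Y → ℝ be a measurable score, and for λ ∈ ℝ define C_λ(x) = {y ∈ Y : s(x,y) ≤ λ}. Let M_λ = #{i ≤ n : s(x_i, y_i) > λ}. Then E[M_λ]/(n+1) ≤ Pr[y_{n+1} ∉ C_λ(x_{n+1})] ≤ (E[M_λ] + 1)/(n+1). -/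
open MeasureTheory

/-- The coordinates of an exchangeable finite family are identically distributed. -/
theorem measure_preimage_eq_of_exchangeable {Ω ι E : Type*} [MeasurableSpace Ω]
    [MeasurableSpace E] [DecidableEq ι] {μ : Measure Ω} {Z : ι → Ω → E}
    (hZ : ∀ i, Measurable (Z i))
    (hexch : ∀ σ : Equiv.Perm ι,
      Measure.map (fun ω => fun i => Z (σ i) ω) μ = Measure.map (fun ω => fun i => Z i ω) μ)
    {A : Set E} (hA : MeasurableSet A) (i j : ι) :
    μ (Z i ⁻¹' A) = μ (Z j ⁻¹' A) := by
  have hB : MeasurableSet ((fun z : ι → E => z j) ⁻¹' A) := measurable_pi_apply j hA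
  have h := congrArg (fun ν => ν ((fun z : ι → E => z j) ⁻¹' A)) (hexch (Equiv.swap i j))
  rw [Measure.map_apply (measurable_pi_lambda _ fun k => hZ _) hB,
    Measure.map_apply (measurable_pi_lambda _ hZ) hB] at h
  simpa [Set.preimage_preimage, Set.preimage] using h

/-- The expected number of events that occur is the sum of their probabilities. -/
theorem integral_card_filter_eq_sum {Ω ι : Type*} [MeasurableSpace Ω] [Fintype ι]
    (μ : Measure Ω) [IsFiniteMeasure μ] {p : ι → Ω → Prop} [∀ ω, DecidablePred fun i => p i ω]
    (hp : ∀ i, MeasurableSet {ω | p i ω}) :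
    ∫ ω, ((Finset.univ.filter fun i => p i ω).card : ℝ) ∂μ = ∑ i, μ.real {ω | p i ω} := by
  have h (ω : Ω) : ((Finset.univ.filter fun i => p i ω).card : ℝ)
      = ∑ i, {ω | p i ω}.indicator (1 : Ω → ℝ) ω := by
    simp [Set.indicator_apply]
  simp_rw [h]
  have hint (i : ι) : Integrable ({ω | p i ω}.indicator (1 : Ω → ℝ)) μ :=
    (integrable_const (1 : ℝ)).indicator (hp i)
  rw [integral_finsetSum _ fun i _ => hint i]
  exact Finset.sum_congr rfl fun i _ => integral_indicator_one (hp i)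

/-- **Miscoverage bound for a fixed threshold (expectation form of the conformal
inversion lemma).**
Let `(x_i, y_i)`, `i = 1, …, n+1`, be exchangeable pairs in `X × Y` (`Y = Fin K`),
`s` a measurable score, `λ ∈ ℝ`, `C_λ(x) = {y | s(x,y) ≤ λ}`, and
`M_λ = #{i ≤ n : s(x_i, y_i) > λ}`.  Then
`E[M_λ]/(n+1) ≤ Pr[y_{n+1} ∉ C_λ(x_{n+1})] ≤ (E[M_λ] + 1)/(n+1)`. -/
theorem miscoverage_bound_fixed_threshold
    {Ω : Type*} [MeasurableSpace Ω] (ℙ : Measure Ω) [IsProbabilityMeasure ℙ]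
    {X : Type*} [MeasurableSpace X] {K : ℕ} (hK : 0 < K) {n : ℕ}
    (Z : Fin (n + 1) → Ω → X × Fin K)
    (hZ : ∀ i, Measurable (Z i))
    (hexch : ∀ σ : Equiv.Perm (Fin (n + 1)),
      Measure.map (fun ω => fun i => Z (σ i) ω) ℙ
        = Measure.map (fun ω => fun i => Z i ω) ℙ)
    (s : X × Fin K → ℝ) (hs : Measurable s)
    (lam : ℝ) :
    (∫ ω, (((Finset.univ.filter fun i : Fin n => lam < s (Z i.castSucc ω)).card : ℝ)) ∂ℙ)
        / ((n : ℝ) + 1)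
      ≤ (ℙ {ω | lam < s (Z (Fin.last n) ω)}).toReal
    ∧ (ℙ {ω | lam < s (Z (Fin.last n) ω)}).toReal
      ≤ ((∫ ω, (((Finset.univ.filter fun i : Fin n => lam < s (Z i.castSucc ω)).card : ℝ)) ∂ℙ)
          + 1) / ((n : ℝ) + 1) := by
  have hA : MeasurableSet {z | lam < s z} := measurableSet_lt measurable_const hs
  set q := (ℙ {ω | lam < s (Z (Fin.last n) ω)}).toReal
  have hmean : ∫ ω, ((Finset.univ.filter fun i : Fin n => lam < s (Z i.castSucc ω)).card : ℝ) ∂ℙ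
      = n * q := by
    rw [integral_card_filter_eq_sum ℙ (p := fun (i : Fin n) ω => lam < s (Z i.castSucc ω))
      fun i => hZ i.castSucc hA]
    have h (i : Fin n) : ℙ.real {ω | lam < s (Z i.castSucc ω)} = q :=
      congrArg ENNReal.toReal
        (measure_preimage_eq_of_exchangeable hZ hexch hA i.castSucc (Fin.last n))
    simp [h]
  have hq_nonneg : 0 ≤ q := ENNReal.toReal_nonneg
  have hq_le_one : q ≤ 1 := measureReal_le_one
  have hn : (0 : ℝ) < n + 1 := by positivity
  rw [hmean, div_le_iff₀ hn, le_div_iff₀ hn]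
  constructor <;> linarith
end
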